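/- Let A be a finitely generated graded algebra over a field k with A = k⟨x₁,…,x_g⟩/I, where I is generated by homogeneous elements r₁, r₂, … of degrees e₁ ≤ e₂ ≤ ⋯ ≥ 2, generators in degree 1. Suppose there exists z₀ ∈ (0,1) such that 1 - g·z₀ + Σ_j z₀^{e_j} converges and is < 0. Then the Hilbert series H_A(z) = Σ dim A_n · zⁿ diverges at z₀; in particular dim A_n grows exponentially in n. -/

import Mathlib

noncomputable section

open FreeAlgebra Filter Topology

/-- The degree-`d` homogeneous component of the free algebra `k⟨x₁,…,x_g⟩`
(standard grading, generators in degree 1): the span of the products of `d` generators. -/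
def freeComp (k : Type*) [Field k] (g : ℕ) (d : ℕ) : Submodule k (FreeAlgebra k (Fin g)) :=
  Submodule.span k {a | ∃ w : List (Fin g), w.length = d ∧ a = (w.map (ι k)).prod}

/-- The degree-`n` component of the quotient of `k⟨x₁,…,x_g⟩` by the two-sided ideal
generated by the relations `r j`: the span of the images of all words of length `n`. -/
def quotComp (k : Type*) [Field k] (g : ℕ) (r : ℕ → FreeAlgebra k (Fin g)) (n : ℕ) :
    Submodule k (RingQuot (fun p q => (∃ j, p = r j) ∧ q = (0 : FreeAlgebra k (Fin g)))) :=
  Submodule.span k {a | ∃ w : List (Fin g), w.length = n ∧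
    a = RingQuot.mkAlgHom k _ ((w.map (ι k)).prod)}

lemma map_prod_mem_freeComp (k : Type*) [Field k] {g : ℕ} (w : List (Fin g)) :
    (w.map (ι k)).prod ∈ freeComp k g w.length :=
  Submodule.subset_span ⟨w, rfl, rfl⟩

lemma freeComp_mul_mem {k : Type*} [Field k] {g m n : ℕ} {a b : FreeAlgebra k (Fin g)}
    (ha : a ∈ freeComp k g m) (hb : b ∈ freeComp k g n) : a * b ∈ freeComp k g (m + n) := by
  have h : freeComp k g m * freeComp k g n ≤ freeComp k g (m + n) := by
    rw [freeComp, freeComp, Submodule.span_mul_span, Submodule.span_le]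
    rintro _ ⟨_, ⟨w, rfl, rfl⟩, _, ⟨v, rfl, rfl⟩, rfl⟩
    have := map_prod_mem_freeComp k (w ++ v)
    simpa using this
  exact h (Submodule.mul_mem_mul ha hb)

lemma basisFreeMonoid_ofList (k : Type*) [Field k] {g : ℕ} (w : List (Fin g)) :
    basisFreeMonoid k (Fin g) (FreeMonoid.ofList w) = (w.map (ι k)).prod := by
  simp [basisFreeMonoid, equivMonoidAlgebraFreeMonoid, FreeMonoid.lift_apply]

lemma freeComp_eq_span_range (k : Type*) [Field k] (g n : ℕ) :
    freeComp k g n = Submodule.span k (Set.range fun w : List.Vector (Fin g) n =>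
      basisFreeMonoid k (Fin g) (FreeMonoid.ofList w.1)) := by
  rw [freeComp]
  congr 1
  ext a
  constructor
  · rintro ⟨w, hw, rfl⟩
    exact ⟨⟨w, hw⟩, basisFreeMonoid_ofList k w⟩
  · rintro ⟨w, rfl⟩
    exact ⟨w.1, w.2, basisFreeMonoid_ofList k w.1⟩

instance finiteDimensional_freeComp (k : Type*) [Field k] (g n : ℕ) :
    FiniteDimensional k (freeComp k g n) := by
  rw [freeComp_eq_span_range]
  exact FiniteDimensional.span_of_finite k (Set.finite_range _)

lemma finrank_freeComp (k : Type*) [Field k] (g n : ℕ) :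
    Module.finrank k (freeComp k g n) = g ^ n := by
  rw [freeComp_eq_span_range, finrank_span_eq_card]
  · simp [card_vector]
  · exact (basisFreeMonoid k (Fin g)).linearIndependent.comp _
      fun v w h => Subtype.ext (FreeMonoid.ofList.injective h)

/-- The projection of the free algebra onto its degree-`n` component. -/
def freeProj (k : Type*) [Field k] (g n : ℕ) :
    FreeAlgebra k (Fin g) →ₗ[k] FreeAlgebra k (Fin g) :=
  (basisFreeMonoid k (Fin g)).constr k fun w =>
    if w.toList.length = n then basisFreeMonoid k (Fin g) w else 0

lemma freeProj_of_mem {k : Type*} [Field k] {g m n : ℕ} {a : FreeAlgebra k (Fin g)}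
    (ha : a ∈ freeComp k g m) : freeProj k g n a = if m = n then a else 0 := by
  rw [freeComp] at ha
  induction ha using Submodule.span_induction with
  | mem x hx =>
    obtain ⟨w, rfl, rfl⟩ := hx
    rw [← basisFreeMonoid_ofList, freeProj, Module.Basis.constr_basis]
    rfl
  | zero => simp
  | add x y _ _ hx hy => rw [map_add, hx, hy]; split_ifs <;> simp
  | smul c x _ hx => rw [map_smul, hx]; split_ifs <;> simp

lemma finrank_finset_sup_le {k V α : Type*} [Field k] [AddCommGroup V] [Module k V]
    (s : Finset α) (p : α → Submodule k V) [∀ i, FiniteDimensional k (p i)] :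
    Module.finrank k (s.sup p : Submodule k V) ≤ ∑ i ∈ s, Module.finrank k (p i) := by
  classical
  induction s using Finset.induction_on with
  | empty => simp
  | insert a s ha ih =>
    rw [Finset.sup_insert, Finset.sum_insert ha]
    have := Submodule.finrank_add_le_finrank_add_finrank (p a) (s.sup p)
    omega

section Relations

variable {k : Type*} [Field k] {g : ℕ} (r : ℕ → FreeAlgebra k (Fin g))

/-- The quotient map from the free algebra to the algebra presented by the relations `r j`. -/
abbrev presMap : FreeAlgebra k (Fin g) →ₐ[k]
    RingQuot (fun p q => (∃ j, p = r j) ∧ q = (0 : FreeAlgebra k (Fin g))) :=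
  RingQuot.mkAlgHom k _

lemma presMap_relation (j : ℕ) : presMap r (r j) = 0 := by
  rw [presMap, RingQuot.mkAlgHom_rel k (s := fun p q => (∃ j, p = r j) ∧ q = 0) ⟨⟨j, rfl⟩, rfl⟩,
    map_zero]

lemma mem_twoSidedIdeal_span_of_presMap_eq_zero {a : FreeAlgebra k (Fin g)}
    (ha : presMap r a = 0) : a ∈ TwoSidedIdeal.span (Set.range r) := by
  set I := TwoSidedIdeal.span (Set.range r)
  have h : ∀ ⦃x y⦄, ((∃ j, x = r j) ∧ y = (0 : FreeAlgebra k (Fin g))) →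
      I.ringCon.mk' x = I.ringCon.mk' y := by
    rintro _ _ ⟨⟨j, rfl⟩, rfl⟩
    rw [map_zero, ← TwoSidedIdeal.mem_ker, TwoSidedIdeal.ker_ringCon_mk']
    exact TwoSidedIdeal.subset_span ⟨j, rfl⟩
  have h1 := RingQuot.lift_mkRingHom_apply I.ringCon.mk' h a
  rw [← RingQuot.mkAlgHom_coe k] at h1
  rw [← TwoSidedIdeal.ker_ringCon_mk' I, TwoSidedIdeal.mem_ker, ← h1]
  change RingQuot.lift _ (presMap r a) = 0
  rw [ha, map_zero]

lemma map_presMap_freeComp (n : ℕ) :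
    (freeComp k g n).map (presMap r).toLinearMap = quotComp k g r n := by
  rw [freeComp, quotComp, Submodule.map_span]
  congr 1
  ext a
  constructor
  · rintro ⟨_, ⟨w, hw, rfl⟩, rfl⟩
    exact ⟨w, hw, rfl⟩
  · rintro ⟨w, hw, rfl⟩
    exact ⟨_, ⟨w, hw, rfl⟩, rfl⟩

instance finiteDimensional_quotComp (n : ℕ) : FiniteDimensional k (quotComp k g r n) := by
  rw [← map_presMap_freeComp]
  infer_instance

/-- The degree-`n` component of the ideal of relations. -/
def relComp (n : ℕ) : Submodule k (FreeAlgebra k (Fin g)) :=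
  freeComp k g n ⊓ LinearMap.ker (presMap r).toLinearMap

instance finiteDimensional_relComp (n : ℕ) : FiniteDimensional k (relComp r n) :=
  Submodule.finiteDimensional_of_le inf_le_left

lemma mem_relComp {n : ℕ} {a : FreeAlgebra k (Fin g)} :
    a ∈ relComp r n ↔ a ∈ freeComp k g n ∧ presMap r a = 0 := Iff.rfl

lemma finrank_quotComp_add_finrank_relComp (n : ℕ) :
    Module.finrank k (quotComp k g r n) + Module.finrank k (relComp r n) = g ^ n := by
  have h := ((presMap r).toLinearMap.domRestrict (freeComp k g n)).finrank_range_add_finrank_ker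
  rw [LinearMap.range_domRestrict, map_presMap_freeComp, finrank_freeComp] at h
  have hK : relComp r n = (LinearMap.ker ((presMap r).toLinearMap.domRestrict
      (freeComp k g n))).map (freeComp k g n).subtype := by
    ext a
    simp [mem_relComp, and_comm]
  rw [← h, hK, Submodule.finrank_map_subtype_eq]

variable {r} {e : ℕ → ℕ}

lemma relComp_le_span (hr : ∀ j, r j ∈ freeComp k g (e j)) (n : ℕ) :
    relComp r n ≤ Submodule.span k {a | ∃ (w v : List (Fin g)) (j : ℕ),
      w.length + e j + v.length = n ∧
        a = (w.map (ι k)).prod * r j * (v.map (ι k)).prod} := by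
  set S := Submodule.span k {a | ∃ (w v : List (Fin g)) (j : ℕ),
      w.length + e j + v.length = n ∧
        a = (w.map (ι k)).prod * r j * (v.map (ι k)).prod}
  have key : ∀ x j y, freeProj k g n (x * r j * y) ∈ S := by
    intro x j y
    induction (basisFreeMonoid k (Fin g)).mem_span x using Submodule.span_induction with
    | zero => simp
    | add x x' _ _ hx hx' => rw [add_mul, add_mul, map_add]; exact S.add_mem hx hx'
    | smul c x _ hx => rw [smul_mul_assoc, smul_mul_assoc, map_smul]; exact S.smul_mem c hx
    | mem x hx =>
    induction (basisFreeMonoid k (Fin g)).mem_span y using Submodule.span_induction with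
    | zero => simp
    | add y y' _ _ hy hy' => rw [mul_add, map_add]; exact S.add_mem hy hy'
    | smul c y _ hy => rw [mul_smul_comm, map_smul]; exact S.smul_mem c hy
    | mem y hy =>
    obtain ⟨w, rfl⟩ := hx
    obtain ⟨v, rfl⟩ := hy
    rw [← FreeMonoid.ofList_toList w, ← FreeMonoid.ofList_toList v, basisFreeMonoid_ofList,
      basisFreeMonoid_ofList, freeProj_of_mem (freeComp_mul_mem (freeComp_mul_mem
        (map_prod_mem_freeComp k _) (hr j)) (map_prod_mem_freeComp k _))]
    split_ifs with h
    · exact Submodule.subset_span ⟨_, _, j, h, rfl⟩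
    · exact S.zero_mem
  rintro a ⟨ha, ha'⟩
  have h1 := mem_twoSidedIdeal_span_of_presMap_eq_zero r ha'
  rw [TwoSidedIdeal.mem_span_iff_mem_addSubgroup_closure] at h1
  have h2 : freeProj k g n a = a := by simp [freeProj_of_mem ha]
  rw [← h2]
  refine AddSubgroup.closure_induction (p := fun a _ => freeProj k g n a ∈ S) ?_ ?_ ?_ ?_ h1
  · rintro _ ⟨_, ⟨x, -, _, ⟨j, rfl⟩, rfl⟩, y, -, rfl⟩
    exact key x j y
  · simp
  · intro x y _ _ hx hy
    rw [map_add]; exact S.add_mem hx hy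
  · intro x _ hx
    rw [map_neg]; exact S.neg_mem hx

lemma relComp_zero (hr : ∀ j, r j ∈ freeComp k g (e j)) (he : ∀ j, 1 ≤ e j) :
    relComp r 0 = ⊥ := by
  rw [eq_bot_iff]
  refine (relComp_le_span hr 0).trans (Submodule.span_le.2 ?_)
  rintro _ ⟨w, v, j, h, -⟩
  have := he j
  omega

variable (r) in
lemma exists_relComp_sup_eq (n : ℕ) :
    ∃ B : Submodule k (FreeAlgebra k (Fin g)), B ≤ freeComp k g n ∧
      relComp r n ⊔ B = freeComp k g n ∧
      Module.finrank k B = Module.finrank k (quotComp k g r n) := by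
  obtain ⟨q, hq⟩ := (relComp r n).exists_isCompl
  have hsup : relComp r n ⊔ q ⊓ freeComp k g n = freeComp k g n := by
    have hle : relComp r n ≤ freeComp k g n := inf_le_left
    rw [← sup_inf_assoc_of_le q hle, hq.sup_eq_top, top_inf_eq]
  have hinf : relComp r n ⊓ (q ⊓ freeComp k g n) = ⊥ := by
    rw [← inf_assoc, hq.inf_eq_bot, bot_inf_eq]
  refine ⟨q ⊓ freeComp k g n, inf_le_right, hsup, ?_⟩
  have : FiniteDimensional k ↥(q ⊓ freeComp k g n) :=
    Submodule.finiteDimensional_of_le inf_le_right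
  have h1 := Submodule.finrank_sup_add_finrank_inf_eq (relComp r n) (q ⊓ freeComp k g n)
  rw [hsup, hinf, finrank_bot, finrank_freeComp] at h1
  have h2 := finrank_quotComp_add_finrank_relComp r n
  omega

lemma mul_mem_sup_relComp_mul_ι {m d : ℕ} {a b : FreeAlgebra k (Fin g)}
    (ha : a ∈ relComp r m) (hb : b ∈ freeComp k g (d + 1)) :
    a * b ∈ Finset.univ.sup fun i : Fin g =>
      (relComp r (m + d)).map (LinearMap.mulRight k (ι k i)) := by
  rw [freeComp] at hb
  induction hb using Submodule.span_induction with
  | mem x hx =>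
    obtain ⟨w, hw, rfl⟩ := hx
    obtain rfl | ⟨v, i, rfl⟩ := w.eq_nil_or_concat'
    · simp at hw
    · refine Finset.le_sup (f := fun i : Fin g =>
        (relComp r (m + d)).map (LinearMap.mulRight k (ι k i))) (Finset.mem_univ i)
        ⟨a * (v.map (ι k)).prod, ?_, by simp [mul_assoc]⟩
      have hv : v.length = d := by simpa using hw
      refine ⟨freeComp_mul_mem ha.1 (hv ▸ map_prod_mem_freeComp k v), ?_⟩
      have := ha.2
      simp_all
  | zero => simp
  | add x y _ _ hx hy => rw [mul_add]; exact Submodule.add_mem _ hx hy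
  | smul c x _ hx => rw [mul_smul_comm]; exact Submodule.smul_mem _ c hx

/-- The Golod–Shafarevich inequality, one coefficient at a time. -/
theorem mul_finrank_quotComp_le (hr : ∀ j, r j ∈ freeComp k g (e j)) (he : ∀ j, 1 ≤ e j)
    (n : ℕ) (J : Finset ℕ) (hJ : ∀ j, e j ≤ n + 1 → j ∈ J) :
    g * Module.finrank k (quotComp k g r n) ≤ Module.finrank k (quotComp k g r (n + 1)) +
      ∑ j ∈ J, Module.finrank k (quotComp k g r (n + 1 - e j)) := by
  choose B hB hsup hrank using exists_relComp_sup_eq r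
  have hfin : ∀ m, FiniteDimensional k (B m) := fun m =>
    Submodule.finiteDimensional_of_le (hB m)
  set P : Fin g → Submodule k (FreeAlgebra k (Fin g)) := fun i =>
    (relComp r n).map (LinearMap.mulRight k (ι k i)) with hP
  set Q : ℕ → Submodule k (FreeAlgebra k (Fin g)) := fun j =>
    (B (n + 1 - e j)).map (LinearMap.mulRight k (r j)) with hQ
  have hle : relComp r (n + 1) ≤ Finset.univ.sup P ⊔ J.sup Q := by
    refine (relComp_le_span hr (n + 1)).trans (Submodule.span_le.2 ?_)
    rintro _ ⟨w, v, j, h, rfl⟩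
    obtain ⟨d, hd⟩ := Nat.exists_eq_add_of_le' (he j)
    obtain hv | hv := Nat.eq_zero_or_pos v.length
    · obtain rfl := List.length_eq_zero_iff.1 hv
      have hw : w.length = n + 1 - e j := by simp at h; omega
      set u := (w.map (ι k)).prod
      have hu : u ∈ freeComp k g (n + 1 - e j) := hw ▸ map_prod_mem_freeComp k w
      rw [← hsup] at hu
      obtain ⟨c, hc, b, hb, hcb⟩ := Submodule.mem_sup.1 hu
      have hsplit : u * r j * (([] : List (Fin g)).map (ι k)).prod = c * r j + b * r j := by
        simp [← hcb, add_mul]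
      rw [hsplit]
      refine Submodule.add_mem_sup ?_ ?_
      · have := mul_mem_sup_relComp_mul_ι hc (hd ▸ hr j)
        rwa [show n + 1 - e j + d = n by simp at h; omega] at this
      · exact Finset.le_sup (f := Q) (hJ j (by simp at h; omega)) ⟨b, hb, rfl⟩
    · obtain ⟨c, hc⟩ := Nat.exists_eq_add_of_le' hv
      refine Submodule.mem_sup_left ?_
      have hwr : (w.map (ι k)).prod * r j ∈ relComp r (w.length + e j) :=
        ⟨freeComp_mul_mem (map_prod_mem_freeComp k w) (hr j), by
          change presMap r _ = 0
          rw [map_mul, presMap_relation, mul_zero]⟩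
      have := mul_mem_sup_relComp_mul_ι hwr (d := c) (hc ▸ map_prod_mem_freeComp k v)
      rwa [show w.length + e j + c = n by omega] at this
  have h1 : Module.finrank k (relComp r (n + 1)) ≤ g * Module.finrank k (relComp r n) +
      ∑ j ∈ J, Module.finrank k (quotComp k g r (n + 1 - e j)) := by
    refine (Submodule.finrank_mono hle).trans
      ((Submodule.finrank_add_le_finrank_add_finrank _ _).trans (add_le_add ?_ ?_))
    · refine (finrank_finset_sup_le _ _).trans ((Finset.sum_le_card_nsmul _ _ _ fun i _ =>
        Submodule.finrank_map_le _ _).trans (by simp))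
    · exact (finrank_finset_sup_le _ _).trans
        (Finset.sum_le_sum fun j _ => (Submodule.finrank_map_le _ _).trans (hrank _).le)
  have h2 := finrank_quotComp_add_finrank_relComp r n
  have h3 := finrank_quotComp_add_finrank_relComp r (n + 1)
  have h4 : g * Module.finrank k (quotComp k g r n) + g * Module.finrank k (relComp r n) =
      g ^ (n + 1) := by rw [← mul_add, h2, pow_succ']
  omega

end Relations

/-- A nonnegative sequence satisfying the Golod–Shafarevich inequalities has a generating series
that diverges wherever `1 - g z + ∑ z ^ e j` is negative. -/
lemma not_summable_of_golod_shafarevich {a : ℕ → ℝ} (ha : ∀ n, 0 ≤ a n) (ha0 : 1 ≤ a 0)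
    {c z : ℝ} {e : ℕ → ℕ} (hz : z ∈ Set.Ioo (0 : ℝ) 1) (hconv : Summable fun j => z ^ e j)
    (hneg : 1 - c * z + ∑' j, z ^ e j < 0)
    (h : ∀ n, ∀ J : Finset ℕ, (∀ j, j ∈ J ↔ e j ≤ n + 1) →
      c * a n ≤ a (n + 1) + ∑ j ∈ J, a (n + 1 - e j)) :
    ¬ Summable fun n => a n * z ^ n := by
  intro hs
  obtain ⟨hz0, hz1⟩ := hz
  have hfin : ∀ n, {j | e j ≤ n}.Finite := by
    intro n
    have h1 := hconv.tendsto_cofinite_zero.eventually_lt_const (pow_pos hz0 n)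
    refine Set.Finite.subset h1 fun j (hj : e j ≤ n) hlt => ?_
    exact absurd hlt (not_lt.2 (pow_le_pow_of_le_one hz0.le hz1.le hj))
  set b : ℕ → ℝ := fun n => a n * z ^ n with hb
  have hb0 : ∀ n, 0 ≤ b n := fun n => mul_nonneg (ha n) (pow_nonneg hz0.le n)
  set H := ∑' n, b n
  set E := ∑' j, z ^ e j
  have hshift : ∀ N j, ∑ n ∈ (Finset.range N).filter (fun n => e j ≤ n + 1), b (n + 1 - e j)
      ≤ H := by
    intro N j
    rw [← Finset.sum_image (f := b) (g := fun n => n + 1 - e j)]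
    · exact hs.sum_le_tsum _ fun n _ => hb0 n
    · intro m hm n hn hmn
      simp only [Finset.coe_filter, Finset.mem_range, Set.mem_ofPred_eq] at hm hn hmn
      omega
  have hH : 0 ≤ H := tsum_nonneg hb0
  have hpart : ∀ N, c * z * ∑ n ∈ Finset.range N, b n ≤ H - 1 + E * H := by
    intro N
    have h1 : ∀ n ∈ Finset.range N, c * z * b n ≤ b (n + 1) +
        ∑ j ∈ (hfin N).toFinset, if e j ≤ n + 1 then z ^ e j * b (n + 1 - e j) else 0 := by
      intro n hn
      have h2 := h n ((hfin N).toFinset.filter fun j => e j ≤ n + 1) (by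
        intro j
        simp only [Finset.mem_filter, Set.Finite.mem_toFinset, Set.mem_ofPred_eq]
        have := Finset.mem_range.1 hn
        omega)
      have h3 := mul_le_mul_of_nonneg_right h2 (pow_nonneg hz0.le (n + 1))
      rw [add_mul, Finset.sum_mul] at h3
      rw [← Finset.sum_filter]
      calc c * z * b n = c * a n * z ^ (n + 1) := by simp only [hb]; ring
        _ ≤ _ := h3
        _ = _ := by
          congr 1
          refine Finset.sum_congr rfl fun j hj => ?_
          have hj' : e j ≤ n + 1 := (Finset.mem_filter.1 hj).2
          simp only [hb]
          rw [mul_left_comm, ← pow_add, Nat.add_sub_cancel' hj']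
    have h4 : ∑ n ∈ Finset.range N, b (n + 1) ≤ H - 1 := by
      have h5 := hs.sum_le_tsum (Finset.range (N + 1)) fun n _ => hb0 n
      rw [Finset.sum_range_succ'] at h5
      have h6 : b 0 = a 0 := by simp [hb]
      change _ ≤ H at h5
      linarith
    rw [Finset.mul_sum]
    refine (Finset.sum_le_sum h1).trans ?_
    rw [Finset.sum_add_distrib, Finset.sum_comm]
    refine add_le_add h4 ?_
    calc _ ≤ ∑ j ∈ (hfin N).toFinset, z ^ e j * H := by
          refine Finset.sum_le_sum fun j _ => ?_
          rw [← Finset.sum_filter, ← Finset.mul_sum]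
          exact mul_le_mul_of_nonneg_left (hshift N j) (pow_nonneg hz0.le _)
      _ ≤ E * H := by
          rw [← Finset.sum_mul]
          exact mul_le_mul_of_nonneg_right
            (hconv.sum_le_tsum _ fun j _ => pow_nonneg hz0.le _) hH
  have hlim := le_of_tendsto' (hs.hasSum.tendsto_sum_nat.const_mul (c * z)) hpart
  change c * z * H ≤ _ at hlim
  nlinarith

/-- The root test in contrapositive form: divergence at `z` bounds the growth rate from below. -/
lemma ofReal_one_div_le_limsup_of_not_summable {a : ℕ → ℝ} (ha : ∀ n, 0 ≤ a n) {z : ℝ}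
    (hz : 0 < z) (h : ¬ Summable fun n => a n * z ^ n) :
    ENNReal.ofReal (1 / z) ≤
      Filter.limsup (fun n => ENNReal.ofReal (a n) ^ (1 / (n : ℝ))) atTop := by
  by_contra! hlt
  obtain ⟨q, hq1, hq2⟩ := exists_between hlt
  have hqtop : q ≠ ⊤ := hq2.ne_top
  lift q to NNReal using hqtop
  have hqz : (q : ℝ) * z < 1 := by
    rw [ENNReal.coe_nnreal_eq, ENNReal.ofReal_lt_ofReal_iff (by positivity)] at hq2
    exact (lt_div_iff₀ hz).1 hq2
  have hev := Filter.eventually_lt_of_limsup_lt hq1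
  refine h (Summable.of_norm_bounded_eventually_nat
    (summable_geometric_of_lt_one (by positivity) hqz) ?_)
  filter_upwards [hev, eventually_gt_atTop 0] with n hn hn0
  have hn0' : (0 : ℝ) < n := by exact_mod_cast hn0
  rw [Real.norm_of_nonneg (mul_nonneg (ha n) (by positivity)), mul_pow]
  refine mul_le_mul_of_nonneg_right ?_ (by positivity)
  have h1 := ENNReal.rpow_le_rpow hn.le hn0'.le
  rw [← ENNReal.rpow_mul, one_div_mul_cancel hn0'.ne', ENNReal.rpow_one, ENNReal.rpow_natCast,
    ENNReal.coe_nnreal_eq, ← ENNReal.ofReal_pow q.coe_nonneg] at h1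
  exact (ENNReal.ofReal_le_ofReal_iff (by positivity)).1 h1

/-- Golod–Shafarevich theorem: if `1 - g z₀ + Σ_j z₀^{e_j} < 0` for some `z₀ ∈ (0,1)`,
then the Hilbert series of `A = k⟨x₁,…,x_g⟩/(r₁, r₂, …)` diverges at `z₀`; in particular
`dim A_n` grows exponentially. -/
theorem stmt_14 (k : Type*) [Field k] (g : ℕ)
    (r : ℕ → FreeAlgebra k (Fin g)) (e : ℕ → ℕ)
    (hhomog : ∀ j, r j ∈ freeComp k g (e j))
    (hmono : Monotone e) (hdeg : ∀ j, 2 ≤ e j)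
    (z₀ : ℝ) (hz₀ : z₀ ∈ Set.Ioo (0 : ℝ) 1)
    (hconv : Summable fun j => z₀ ^ e j)
    (hneg : 1 - g * z₀ + ∑' j, z₀ ^ e j < 0) :
    ¬ (Summable fun n => (Module.finrank k (quotComp k g r n) : ℝ) * z₀ ^ n) ∧
      ENNReal.ofReal (1 / z₀) ≤
        Filter.limsup
          (fun n => ENNReal.ofReal (Module.finrank k (quotComp k g r n)) ^ (1 / (n : ℝ)))
          atTop := by
  have he : ∀ j, 1 ≤ e j := fun j => one_le_two.trans (hdeg j)
  have hdiv : ¬ Summable fun n => (Module.finrank k (quotComp k g r n) : ℝ) * z₀ ^ n := by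
    refine not_summable_of_golod_shafarevich
      (a := fun n => (Module.finrank k (quotComp k g r n) : ℝ))
      (fun n => Nat.cast_nonneg _) ?_ hz₀ hconv hneg fun n J hJ => ?_
    · have h0 := finrank_quotComp_add_finrank_relComp r 0
      rw [relComp_zero hhomog he, finrank_bot, add_zero, pow_zero] at h0
      simp [h0]
    · exact_mod_cast mul_finrank_quotComp_le hhomog he n J fun j hj => (hJ j).2 hj
  exact ⟨hdiv, ofReal_one_div_le_limsup_of_not_summable (fun n => Nat.cast_nonneg _) hz₀.1 hdiv⟩

end
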